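/- There exists an absolute constant C > 0 such that for every ε ∈ (0, 1] the following holds. Let R = [0, 1] × [−2ε^{−1/2}, 0] be an axis-parallel rectangle of width 1 and height 2ε^{−1/2}, let Q = [0, 1] × [0, 1] be the unit square adjacent to the top side of R, and let L be a tame path contained in Q. Then there exists a geometric graph E comprised of the edges of L together with additional segments of total weight at most C · ε^{−1/2}, such that for every a ∈ L and every point b on the bottom side [0,1] × {−2ε^{−1/2}} of R, there is an ab-path P in E with weight ‖P‖ ≤ (1 + C·ε)·‖a − b‖. -/

import Mathlib

open scoped Classical

noncomputable section

/-- The Euclidean plane. -/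
abbrev Plane : Type := EuclideanSpace ℝ (Fin 2)

/-- The point `(x, y) ∈ ℝ²`. -/
def pt (x y : ℝ) : Plane := (EuclideanSpace.equiv (Fin 2) ℝ).symm ![x, y]

/-- The union of the segments of a geometric graph. -/
def segUnion (E : Finset (Plane × Plane)) : Set Plane :=
  ⋃ e ∈ E, segment ℝ e.1 e.2

/-- The total weight of a geometric graph: the sum of the Euclidean lengths of its
segments. -/
def gweight (E : Finset (Plane × Plane)) : ℝ :=
  ∑ e ∈ E, ‖e.1 - e.2‖

/-- `HasPath E s t w` : there is a polygonal path from `s` to `t`, each of whose edges is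
contained in the union of the segments of `E`, of weight at most `w`. -/
def HasPath (E : Finset (Plane × Plane)) (s t : Plane) (w : ℝ) : Prop :=
  ∃ (m : ℕ) (v : ℕ → Plane), v 0 = s ∧ v m = t ∧
    (∀ i < m, segment ℝ (v i) (v (i + 1)) ⊆ segUnion E) ∧
    ∑ i ∈ Finset.range m, ‖v (i + 1) - v i‖ ≤ w

/-- A rectilinear path: every edge is horizontal or vertical. -/
def IsRectilinear (n : ℕ) (u : ℕ → Plane) : Prop :=
  ∀ i < n, u i 0 = u (i + 1) 0 ∨ u i 1 = u (i + 1) 1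

/-- The set of points of the polygonal path with vertices `u 0, …, u n`. -/
def pathSet (n : ℕ) (u : ℕ → Plane) : Set Plane :=
  ⋃ i ∈ Finset.range n, segment ℝ (u i) (u (i + 1))

/-- The edges of the polygonal path with vertices `u 0, …, u n`, as a geometric graph. -/
def pathEdges (n : ℕ) (u : ℕ → Plane) : Finset (Plane × Plane) :=
  (Finset.range n).image fun i => (u i, u (i + 1))

/-- The region below an `x`-monotone path with point set `L` : points `p` that lie
vertically below some point of `L` and not below the lowest point of `L`. -/
def belowRegion (L : Set Plane) : Set Plane :=
  {p | (∃ q ∈ L, q 0 = p 0 ∧ p 1 ≤ q 1) ∧ (∃ q ∈ L, q 1 ≤ p 1)}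

/-- The length of the subpath of the path `u 0, …, u n` from a point `a` on the `i`-th
edge to a point `b` on the `j`-th edge (for `i ≤ j`). -/
def subLen (u : ℕ → Plane) (i j : ℕ) (a b : Plane) : ℝ :=
  if i = j then ‖b - a‖
  else ‖u (i + 1) - a‖ + (∑ k ∈ Finset.Ico (i + 1) j, ‖u (k + 1) - u k‖) + ‖b - u j‖

/-- The point set of the subpath of the path `u 0, …, u n` from a point `a` on the `i`-th
edge to a point `b` on the `j`-th edge (for `i ≤ j`). -/
def subSet (u : ℕ → Plane) (i j : ℕ) (a b : Plane) : Set Plane :=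
  if i = j then segment ℝ a b
  else segment ℝ a (u (i + 1)) ∪
    (⋃ k ∈ Finset.Ico (i + 1) j, segment ℝ (u k) (u (k + 1))) ∪ segment ℝ (u j) b

/-- A tame path: an `x`-monotone (nondecreasing) rectilinear path such that for every
horizontal chord `ab` (with `a`, `b` on the path and the segment `ab` contained in the
region below the path), the subpath between `a` and `b` has length at most `2·‖a − b‖`. -/
def IsTamePath (n : ℕ) (u : ℕ → Plane) : Prop :=
  IsRectilinear n u ∧ (∀ i < n, u i 0 ≤ u (i + 1) 0) ∧
  ∀ (i j : ℕ) (a b : Plane), i ≤ j → j < n →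
    a ∈ segment ℝ (u i) (u (i + 1)) → b ∈ segment ℝ (u j) (u (j + 1)) →
    a 1 = b 1 → segment ℝ a b ⊆ belowRegion (pathSet n u) →
    subLen u i j a b ≤ 2 * ‖a - b‖

namespace Plane

theorem norm_eq_sqrt (p : Plane) : ‖p‖ = Real.sqrt (p 0 ^ 2 + p 1 ^ 2) := by
  simp [EuclideanSpace.norm_eq, Fin.sum_univ_two]

theorem abs_snd_le_norm (p : Plane) : |p 1| ≤ ‖p‖ := by
  rw [norm_eq_sqrt]
  exact Real.abs_le_sqrt (by nlinarith [sq_nonneg (p 0)])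

theorem norm_le_abs_add_abs (p : Plane) : ‖p‖ ≤ |p 0| + |p 1| := by
  rw [norm_eq_sqrt, Real.sqrt_le_left (by positivity)]
  nlinarith [sq_abs (p 0), sq_abs (p 1), mul_nonneg (abs_nonneg (p 0)) (abs_nonneg (p 1))]

theorem norm_eq_abs_fst {p : Plane} (h : p 1 = 0) : ‖p‖ = |p 0| := by
  rw [norm_eq_sqrt, h]
  simp [Real.sqrt_sq_eq_abs]

theorem norm_le_add_sq_div {p : Plane} {d v : ℝ} (hv : 0 < v) (h₀ : |p 0| ≤ d)
    (h₁ : |p 1| = v) : ‖p‖ ≤ v + d ^ 2 / (2 * v) := by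
  have hd : p 0 ^ 2 ≤ d ^ 2 := by
    rw [← sq_abs]
    exact pow_le_pow_left₀ (abs_nonneg _) h₀ 2
  have hsq : p 1 ^ 2 = v ^ 2 := by rw [← sq_abs, h₁]
  rw [norm_eq_sqrt, Real.sqrt_le_left (by positivity), hsq]
  have hexp : (v + d ^ 2 / (2 * v)) ^ 2 = v ^ 2 + d ^ 2 + (d ^ 2 / (2 * v)) ^ 2 := by
    field_simp
    ring
  nlinarith [sq_nonneg (d ^ 2 / (2 * v))]

theorem ext {p q : Plane} (h₀ : p 0 = q 0) (h₁ : p 1 = q 1) : p = q := by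
  ext i
  fin_cases i <;> assumption

end Plane

@[simp] theorem pt_zero (x y : ℝ) : pt x y 0 = x := by simp [pt]

@[simp] theorem pt_one (x y : ℝ) : pt x y 1 = y := by simp [pt]

theorem pt_eta (p : Plane) : pt (p 0) (p 1) = p := Plane.ext (by simp) (by simp)

theorem mem_segment_coord {p a b : Plane} (h : p ∈ segment ℝ a b) (i : Fin 2) :
    p i ∈ segment ℝ (a i) (b i) := by
  obtain ⟨s, t, hs, ht, hst, rfl⟩ := h
  exact ⟨s, t, hs, ht, hst, by simp⟩

theorem pt_mem_segment_horizontal {x x₁ x₂ y : ℝ} (h : x ∈ Set.Icc x₁ x₂) :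
    pt x y ∈ segment ℝ (pt x₁ y) (pt x₂ y) := by
  rw [← segment_eq_Icc (h.1.trans h.2)] at h
  obtain ⟨s, t, hs, ht, hst, rfl⟩ := h
  refine ⟨s, t, hs, ht, hst, Plane.ext (by simp) ?_⟩
  simp [← add_mul, hst]

theorem pt_mem_segment_vertical {x y y₁ y₂ : ℝ} (h : y ∈ Set.Icc y₁ y₂) :
    pt x y ∈ segment ℝ (pt x y₁) (pt x y₂) := by
  rw [← segment_eq_Icc (h.1.trans h.2)] at h
  obtain ⟨s, t, hs, ht, hst, rfl⟩ := h
  refine ⟨s, t, hs, ht, hst, Plane.ext ?_ (by simp)⟩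
  simp [← add_mul, hst]

theorem segment_subset_segUnion {E : Finset (Plane × Plane)} {e : Plane × Plane} (he : e ∈ E)
    {p q : Plane} (hp : p ∈ segment ℝ e.1 e.2) (hq : q ∈ segment ℝ e.1 e.2) :
    segment ℝ p q ⊆ segUnion E :=
  ((convex_segment _ _).segment_subset hp hq).trans
    (Set.subset_biUnion_of_mem (u := fun e : Plane × Plane => segment ℝ e.1 e.2) he)

theorem gweight_union_le (E F : Finset (Plane × Plane)) :
    gweight (E ∪ F) ≤ gweight E + gweight F := by
  unfold gweight
  rw [← Finset.sum_union_inter]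
  exact le_add_of_nonneg_right (Finset.sum_nonneg fun _ _ => norm_nonneg _)

theorem gweight_image_range_le (f : ℕ → Plane × Plane) (N : ℕ) {m : ℝ} (hm : 0 ≤ m)
    (h : ∀ i < N, ‖(f i).1 - (f i).2‖ ≤ m) :
    gweight ((Finset.range N).image f) ≤ N * m := by
  have h₁ : gweight ((Finset.range N).image f) ≤ ((Finset.range N).image f).card • m := by
    refine Finset.sum_le_card_nsmul _ _ _ fun e he => ?_
    obtain ⟨i, hi, rfl⟩ := Finset.mem_image.1 he
    exact h i (Finset.mem_range.1 hi)
  have h₂ : (((Finset.range N).image f).card : ℝ) ≤ N := by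
    exact_mod_cast Finset.card_image_le.trans (Finset.card_range N).le
  rw [nsmul_eq_mul] at h₁
  exact h₁.trans (mul_le_mul_of_nonneg_right h₂ hm)

namespace HasPath

variable {E F : Finset (Plane × Plane)} {p q r : Plane} {w w₁ w₂ : ℝ}

theorem mono (h : HasPath E p q w₁) (hE : E ⊆ F) (hw : w₁ ≤ w₂) : HasPath F p q w₂ := by
  obtain ⟨m, v, h₀, h₁, h₂, h₃⟩ := h
  exact ⟨m, v, h₀, h₁, fun i hi => (h₂ i hi).trans
    (Set.biUnion_subset_biUnion_left fun e he => hE he), h₃.trans hw⟩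

theorem refl (hw : 0 ≤ w) : HasPath E p p w :=
  ⟨0, fun _ => p, rfl, rfl, by simp, by simpa using hw⟩

theorem single (h : segment ℝ p q ⊆ segUnion E) (hw : ‖q - p‖ ≤ w) : HasPath E p q w := by
  refine ⟨1, fun i => if i = 0 then p else q, by simp, by simp, ?_, by simpa using hw⟩
  intro i hi
  obtain rfl : i = 0 := by omega
  simpa using h

theorem of_mem {e : Plane × Plane} (he : e ∈ E) (hp : p ∈ segment ℝ e.1 e.2)
    (hq : q ∈ segment ℝ e.1 e.2) (hw : ‖q - p‖ ≤ w) : HasPath E p q w :=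
  single (segment_subset_segUnion he hp hq) hw

theorem symm (h : HasPath E p q w) : HasPath E q p w := by
  obtain ⟨m, v, h₀, h₁, h₂, h₃⟩ := h
  refine ⟨m, fun i => v (m - i), by simpa using h₁, by simpa using h₀, fun i hi => ?_, ?_⟩
  · have := h₂ (m - (i + 1)) (by omega)
    rwa [show m - (i + 1) + 1 = m - i by omega, segment_symm] at this
  · rw [← Finset.sum_range_reflect] at h₃
    refine le_trans (Finset.sum_le_sum fun i hi => ?_) h₃
    have hi := Finset.mem_range.1 hi
    beta_reduce
    rw [norm_sub_rev, show m - 1 - i + 1 = m - i by omega, show m - (i + 1) = m - 1 - i by omega]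

theorem trans (h : HasPath E p q w₁) (h' : HasPath E q r w₂) : HasPath E p r (w₁ + w₂) := by
  obtain ⟨m, v, h₀, h₁, h₂, h₃⟩ := h
  obtain ⟨m', v', h₀', h₁', h₂', h₃'⟩ := h'
  set z : ℕ → Plane := fun i => if i ≤ m then v i else v' (i - m) with hz
  have hz₁ : ∀ i ≤ m, z i = v i := fun i hi => by simp [hz, hi]
  have hz₂ : ∀ i, z (m + i) = v' i := by
    intro i
    rcases Nat.eq_zero_or_pos i with rfl | hi
    · simp [hz, h₁, h₀']
    · simp [hz, show ¬ i = 0 by omega]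
  refine ⟨m + m', z, by rw [hz₁ 0 (by omega), h₀], by rw [hz₂, h₁'], fun i hi => ?_, ?_⟩
  · rcases lt_or_ge i m with him | him
    · rw [hz₁ i him.le, hz₁ (i + 1) him]
      exact h₂ i him
    · obtain ⟨j, rfl⟩ := Nat.exists_eq_add_of_le him
      rw [hz₂, add_assoc, hz₂]
      exact h₂' j (by omega)
  · rw [Finset.sum_range_add]
    refine add_le_add (le_trans (Finset.sum_le_sum fun i hi => ?_) h₃)
      (le_trans (Finset.sum_le_sum fun i _ => ?_) h₃')
    · have hi := Finset.mem_range.1 hi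
      rw [hz₁ i hi.le, hz₁ (i + 1) hi]
    · rw [hz₂, add_assoc, hz₂]

end HasPath

theorem exists_grid_cell {N : ℕ} (hN : 0 < N) {v : ℝ} (hv : v ∈ Set.Icc 0 1) :
    ∃ i < N, (i : ℝ) / N ≤ v ∧ v ≤ (i : ℝ) / N + 1 / N := by
  have hN' : (0 : ℝ) < N := by exact_mod_cast hN
  simp only [← add_div, div_le_iff₀ hN', le_div_iff₀ hN']
  rcases hv.2.eq_or_lt with rfl | hlt
  · refine ⟨N - 1, by omega, ?_⟩
    rw [Nat.cast_sub hN]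
    simp
  · have hnn : 0 ≤ v * N := mul_nonneg hv.1 hN'.le
    exact ⟨⌊v * N⌋₊, (Nat.floor_lt hnn).2 (by nlinarith), Nat.floor_le hnn,
      (Nat.lt_floor_add_one _).le⟩

/-- Coordinate functions `x`, `y` and an arc length function `l` of a tame path with `n` edges,
parametrized so that the `k`-th edge is traversed during `[k, k + 1]`. -/
structure IsTameProfile (n : ℕ) (x y l : ℝ → ℝ) : Prop where
  continuous_fst : Continuous x
  continuous_snd : Continuous y
  monotone_fst : Monotone x
  edge_length : ∀ k < n, ∀ s t : ℝ, (k : ℝ) ≤ s → s ≤ t → t ≤ k + 1 →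
    l t - l s ≤ (x t - x s) + |y t - y s|
  edge_snd : ∀ k < n, MonotoneOn y (Set.Icc k (k + 1)) ∨ AntitoneOn y (Set.Icc k (k + 1))
  chord_length : ∀ s t : ℝ, 0 ≤ s → s ≤ t → t ≤ n → y s = y t →
    (∀ r ∈ Set.Icc s t, y t ≤ y r) → l t - l s ≤ 2 * (x t - x s)

namespace IsTameProfile

variable {n : ℕ} {x y l : ℝ → ℝ}

theorem reverse (h : IsTameProfile n x y l) :
    IsTameProfile n (fun t => -x (n - t)) (fun t => y (n - t)) (fun t => -l (n - t)) where
  continuous_fst := (h.continuous_fst.comp (by fun_prop)).neg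
  continuous_snd := h.continuous_snd.comp (by fun_prop)
  monotone_fst s t hst := neg_le_neg (h.monotone_fst (by linarith))
  edge_length k hk s t hs hst ht := by
    have hc : ((n - 1 - k : ℕ) : ℝ) = n - 1 - k := by
      rw [Nat.cast_sub (by omega), Nat.cast_sub (by omega), Nat.cast_one]
    have := h.edge_length (n - 1 - k) (by omega) (n - t) (n - s) (by rw [hc]; linarith)
      (by linarith) (by rw [hc]; linarith)
    rw [abs_sub_comm] at this
    linarith
  edge_snd k hk := by
    have hc : ((n - 1 - k : ℕ) : ℝ) = n - 1 - k := by
      rw [Nat.cast_sub (by omega), Nat.cast_sub (by omega), Nat.cast_one]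
    have hmem : ∀ s ∈ Set.Icc (k : ℝ) (k + 1),
        (n : ℝ) - s ∈ Set.Icc ((n - 1 - k : ℕ) : ℝ) ((n - 1 - k : ℕ) + 1) := by
      intro s hs
      rw [hc]
      exact ⟨by linarith [hs.2], by linarith [hs.1]⟩
    rcases h.edge_snd (n - 1 - k) (by omega) with hm | hm
    · exact Or.inr fun s hs t ht hst => hm (hmem t ht) (hmem s hs) (by linarith)
    · exact Or.inl fun s hs t ht hst => hm (hmem t ht) (hmem s hs) (by linarith)
  chord_length s t hs hst ht hy hr := by
    have := h.chord_length (n - t) (n - s) (by linarith) (by linarith) (by linarith) hy.symm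
      (fun r hr' => by
        have := hr (n - r) ⟨by linarith [hr'.2], by linarith [hr'.1]⟩
        simp only [sub_sub_cancel] at this
        linarith)
    linarith

theorem length_le_of_min_left (h : IsTameProfile n x y l) {k : ℕ} (hk : k ≤ n) :
    ∀ {s t : ℝ}, 0 ≤ s → s ≤ t → t ≤ k → (∀ r ∈ Set.Icc s t, y s ≤ y r) →
      l t - l s ≤ 2 * (x t - x s) + (y t - y s) := by
  induction k with
  | zero =>
    intro s t hs hst ht _
    obtain rfl : s = t := le_antisymm hst (by simpa using ht.trans (by simpa using hs))
    simp
  | succ k ih =>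
    intro s t hs hst ht hmin
    push_cast at ht
    have ih := @ih (by omega)
    rcases le_or_gt t k with htk | htk
    · exact ih hs hst htk hmin
    have hyt := hmin t ⟨hst, le_rfl⟩
    rcases le_or_gt (k : ℝ) s with hsk | hsk
    · have h₁ := h.edge_length k (by omega) s t hsk hst ht
      rw [abs_of_nonneg (by linarith)] at h₁
      linarith [h.monotone_fst hst]
    have h₁ := h.edge_length k (by omega) k t le_rfl htk.le ht
    rcases le_or_gt (y k) (y t) with hyk | hyk
    · have h₂ := ih hs hsk.le le_rfl fun r hr => hmin r ⟨hr.1, hr.2.trans htk.le⟩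
      rw [abs_of_nonneg (by linarith)] at h₁
      linarith [h.monotone_fst htk.le]
    have hkmem : (k : ℝ) ∈ Set.Icc (k : ℝ) (k + 1) := ⟨le_rfl, by linarith⟩
    have htmem : t ∈ Set.Icc (k : ℝ) (k + 1) := ⟨htk.le, ht⟩
    have hanti : AntitoneOn y (Set.Icc k (k + 1)) :=
      (h.edge_snd k (by omega)).resolve_left fun hm => (hm hkmem htmem htk.le).not_gt hyk
    have hcomp : IsCompact (Set.Icc s k ∩ {r | y r ≤ y t}) :=
      isCompact_Icc.inter_right (isClosed_le h.continuous_snd continuous_const)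
    obtain ⟨r, ⟨hr, hry⟩, hmax⟩ := hcomp.exists_isGreatest ⟨s, ⟨le_rfl, hsk.le⟩, hyt⟩
    have hryt : y r = y t := by
      obtain ⟨r', hr', hyr'⟩ := intermediate_value_Icc hr.2 h.continuous_snd.continuousOn
        (show y t ∈ Set.Icc (y r) (y k) from ⟨hry, hyk.le⟩)
      have := hmax ⟨⟨hr.1.trans hr'.1, hr'.2⟩, hyr'.le⟩
      rw [← hyr', le_antisymm this hr'.1]
    have hchord := h.chord_length r t (hs.trans hr.1) (hr.2.trans htk.le)
      (ht.trans (by exact_mod_cast hk)) hryt (fun q hq => by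
        rcases le_or_gt q k with hqk | hqk
        · by_contra! hlt
          have := hmax ⟨⟨hr.1.trans hq.1, hqk⟩, hlt.le⟩
          rw [le_antisymm this hq.1, hryt] at hlt
          exact lt_irrefl _ hlt
        · exact hanti ⟨hqk.le, hq.2.trans ht⟩ htmem hq.2)
    have h₂ := ih hs hr.1 hr.2 fun q hq => hmin q ⟨hq.1, hq.2.trans (hr.2.trans htk.le)⟩
    linarith

theorem length_le_of_min_right (h : IsTameProfile n x y l) {s t : ℝ} (hs : 0 ≤ s) (hst : s ≤ t)
    (ht : t ≤ n) (hmin : ∀ r ∈ Set.Icc s t, y t ≤ y r) :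
    l t - l s ≤ 2 * (x t - x s) + (y s - y t) := by
  have := h.reverse.length_le_of_min_left le_rfl (s := n - t) (t := n - s) (by linarith)
    (by linarith) (by linarith) (fun r hr => by
      simp only [sub_sub_cancel]
      exact hmin _ ⟨by linarith [hr.2], by linarith [hr.1]⟩)
  simp only [sub_sub_cancel] at this
  linarith

/-- A piece of a tame path inside a `d × d` box has length at most `4 * d`. -/
theorem length_le_of_box (h : IsTameProfile n x y l) {s t c d : ℝ} (hs : 0 ≤ s) (hst : s ≤ t)
    (ht : t ≤ n) (hx : x t - x s ≤ d) (hy : ∀ r ∈ Set.Icc s t, y r ∈ Set.Icc c (c + d)) :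
    l t - l s ≤ 4 * d := by
  obtain ⟨r, hr, hmin⟩ := (isCompact_Icc (a := s) (b := t)).exists_isMinOn
    ⟨s, le_rfl, hst⟩ h.continuous_snd.continuousOn
  have h₁ := h.length_le_of_min_right hs hr.1 (hr.2.trans ht)
    fun q hq => hmin ⟨hq.1, hq.2.trans hr.2⟩
  have h₂ := h.length_le_of_min_left le_rfl (hs.trans hr.1) hr.2 ht
    fun q hq => hmin ⟨hr.1.trans hq.1, hq.2⟩
  linarith [(hy r hr).1, (hy s ⟨le_rfl, hst⟩).2, (hy t ⟨hst, le_rfl⟩).2]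

/-- Walking back along a tame path inside the unit square, one reaches its start or the grid of
mesh `1 / N` within distance `4 / N`. -/
theorem exists_grid_point (h : IsTameProfile n x y l) {N : ℕ} (hN : 0 < N) {t : ℝ} (ht₀ : 0 ≤ t)
    (ht : t ≤ n) (hx : x t ∈ Set.Icc 0 1) (hy : y t ∈ Set.Icc 0 1) :
    ∃ s, 0 ≤ s ∧ s ≤ t ∧ l t - l s ≤ 4 * (1 / N) ∧ y s ≤ y t + 1 / N ∧
      (s = 0 ∨ (∃ i < N, x s = (i : ℝ) / N) ∨ ∃ j ≤ N, y s = (j : ℝ) / N) := by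
  obtain ⟨i, hi, hix, hxi⟩ := exists_grid_cell hN hx
  obtain ⟨j, hj, hjy, hyj⟩ := exists_grid_cell hN hy
  have hj₁ : (j : ℝ) / N + 1 / N = ((j + 1 : ℕ) : ℝ) / N := by
    push_cast
    ring
  set Z : Set ℝ := {r | r = 0} ∪ ({r | x r = (i : ℝ) / N} ∪
    ({r | y r = (j : ℝ) / N} ∪ {r | y r = ((j + 1 : ℕ) : ℝ) / N}))
  have hclosed : IsClosed Z :=
    (isClosed_eq continuous_id continuous_const).union
      ((isClosed_eq h.continuous_fst continuous_const).union
        ((isClosed_eq h.continuous_snd continuous_const).union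
          (isClosed_eq h.continuous_snd continuous_const)))
  obtain ⟨s, ⟨⟨hs₀, hst⟩, hsZ⟩, hmax⟩ :=
    (isCompact_Icc.inter_right hclosed).exists_isGreatest
      (show (Set.Icc 0 t ∩ Z).Nonempty from ⟨0, ⟨le_rfl, ht₀⟩, Or.inl rfl⟩)
  have hlast : ∀ r ∈ Set.Icc s t, r ∈ Z → r = s := fun r hr hrZ =>
    le_antisymm (hmax ⟨⟨hs₀.trans hr.1, hr.2⟩, hrZ⟩) hr.1
  have hxs : (i : ℝ) / N ≤ x s := by
    by_contra! hlt
    obtain ⟨r, hr, hxr⟩ := intermediate_value_Icc hst h.continuous_fst.continuousOn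
      (show (i : ℝ) / N ∈ Set.Icc (x s) (x t) from ⟨hlt.le, hix⟩)
    rw [hlast r hr (Or.inr (Or.inl hxr))] at hxr
    linarith
  have hbox : ∀ r ∈ Set.Icc s t, y r ∈ Set.Icc ((j : ℝ) / N) (j / N + 1 / N) := by
    intro r hr
    constructor
    · by_contra! hlt
      obtain ⟨q, hq, hyq⟩ := intermediate_value_Icc hr.2 h.continuous_snd.continuousOn
        (show (j : ℝ) / N ∈ Set.Icc (y r) (y t) from ⟨hlt.le, hjy⟩)
      have hqs := hlast q ⟨hr.1.trans hq.1, hq.2⟩ (Or.inr (Or.inr (Or.inl hyq)))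
      rw [le_antisymm hq.1 (hqs ▸ hr.1)] at hlt
      exact hlt.ne hyq
    · by_contra! hlt
      rw [hj₁] at hlt hyj
      obtain ⟨q, hq, hyq⟩ := intermediate_value_Icc' hr.2 h.continuous_snd.continuousOn
        (show ((j + 1 : ℕ) : ℝ) / N ∈ Set.Icc (y t) (y r) from ⟨hyj, hlt.le⟩)
      have hqs := hlast q ⟨hr.1.trans hq.1, hq.2⟩ (Or.inr (Or.inr (Or.inr hyq)))
      rw [le_antisymm hq.1 (hqs ▸ hr.1)] at hlt
      exact hlt.ne hyq.symm
  refine ⟨s, hs₀, hst, h.length_le_of_box hs₀ hst ht (by linarith) hbox,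
    by linarith [(hbox s ⟨le_rfl, hst⟩).2], ?_⟩
  rcases hsZ with hs | hs | hs | hs
  · exact Or.inl hs
  · exact Or.inr (Or.inl ⟨i, hi, hs⟩)
  · exact Or.inr (Or.inr ⟨j, hj.le, hs⟩)
  · exact Or.inr (Or.inr ⟨j + 1, hj, hs⟩)

end IsTameProfile

section Interpolation

variable {V : Type*} [AddCommGroup V] [Module ℝ V]

/-- The piecewise affine curve on `[0, n]` that takes the value `f k` at `k`. -/
def interp (n : ℕ) (f : ℕ → V) (t : ℝ) : V :=
  f 0 + ∑ k ∈ Finset.range n, max 0 (min 1 (t - k)) • (f (k + 1) - f k)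

theorem interp_of_mem {n k : ℕ} (hk : k < n) (f : ℕ → V) {t : ℝ} (h₀ : (k : ℝ) ≤ t)
    (h₁ : t ≤ k + 1) : interp n f t = f k + (t - k) • (f (k + 1) - f k) := by
  obtain ⟨m, rfl⟩ := Nat.exists_eq_add_of_lt hk
  have hbefore : ∀ i ∈ Finset.range k,
      max 0 (min 1 (t - i)) • (f (i + 1) - f i) = f (i + 1) - f i := by
    intro i hi
    have : (i : ℝ) + 1 ≤ k := by exact_mod_cast Finset.mem_range.1 hi
    rw [min_eq_left (by linarith), max_eq_right zero_le_one, one_smul]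
  have hafter : ∀ i ∈ Finset.range m, max 0 (min 1 (t - ((k + 1 + i : ℕ) : ℝ))) •
      (f (k + 1 + i + 1) - f (k + 1 + i)) = 0 := by
    intro i _
    have : (0 : ℝ) ≤ i := i.cast_nonneg
    rw [max_eq_left, zero_smul]
    refine (min_le_right _ _).trans ?_
    push_cast
    linarith
  rw [interp, show k + m + 1 = k + 1 + m by ring, Finset.sum_range_add, Finset.sum_range_succ,
    Finset.sum_congr rfl hbefore, Finset.sum_range_sub, Finset.sum_eq_zero hafter,
    min_eq_right (by linarith), max_eq_right (by linarith)]
  abel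

theorem interp_sub_of_mem {n k : ℕ} (hk : k < n) (f : ℕ → V) {s t : ℝ} (hs : (k : ℝ) ≤ s)
    (hst : s ≤ t) (ht : t ≤ k + 1) :
    interp n f t - interp n f s = (t - s) • (f (k + 1) - f k) := by
  rw [interp_of_mem hk f (hs.trans hst) ht, interp_of_mem hk f hs (hst.trans ht),
    add_sub_add_left_eq_sub, ← sub_smul, sub_sub_sub_cancel_right]

theorem interp_mem_segment {n k : ℕ} (hk : k < n) (f : ℕ → V) {t : ℝ} (h₀ : (k : ℝ) ≤ t)
    (h₁ : t ≤ k + 1) : interp n f t ∈ segment ℝ (f k) (f (k + 1)) := by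
  rw [interp_of_mem hk f h₀ h₁, segment_eq_image']
  exact ⟨t - k, ⟨by linarith, by linarith⟩, rfl⟩

theorem exists_interp_eq {n k : ℕ} (hk : k < n) {f : ℕ → V} {p : V}
    (hp : p ∈ segment ℝ (f k) (f (k + 1))) :
    ∃ t : ℝ, (k : ℝ) ≤ t ∧ t ≤ k + 1 ∧ interp n f t = p := by
  rw [segment_eq_image'] at hp
  obtain ⟨θ, hθ, rfl⟩ := hp
  refine ⟨k + θ, by linarith [hθ.1], by linarith [hθ.2], ?_⟩
  rw [interp_of_mem hk f (by linarith [hθ.1]) (by linarith [hθ.2]), add_sub_cancel_left]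

end Interpolation

theorem exists_edge_index {n : ℕ} (hn : 0 < n) {t : ℝ} (h₀ : 0 ≤ t) (h₁ : t ≤ n) :
    ∃ k < n, (k : ℝ) ≤ t ∧ t ≤ k + 1 := by
  rcases h₁.eq_or_lt with rfl | hlt
  · refine ⟨n - 1, by omega, ?_⟩
    rw [Nat.cast_sub hn]
    simp
  · exact ⟨⌊t⌋₊, (Nat.floor_lt h₀).2 hlt, Nat.floor_le h₀, (Nat.lt_floor_add_one t).le⟩

theorem interp_apply (n : ℕ) (u : ℕ → Plane) (t : ℝ) (i : Fin 2) :
    interp n u t i = interp n (fun k => u k i) t := by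
  simp [interp]

theorem continuous_interp (n : ℕ) (f : ℕ → ℝ) : Continuous (interp n f) := by
  unfold interp
  fun_prop

theorem monotone_interp {n : ℕ} {f : ℕ → ℝ} (h : ∀ k < n, f k ≤ f (k + 1)) :
    Monotone (interp n f) := by
  intro s t hst
  unfold interp
  gcongr with k hk
  exact sub_nonneg.2 (h k (Finset.mem_range.1 hk))

theorem interp_mem_pathSet {n : ℕ} (hn : 0 < n) (u : ℕ → Plane) {t : ℝ} (h₀ : 0 ≤ t)
    (h₁ : t ≤ n) : interp n u t ∈ pathSet n u := by
  obtain ⟨k, hk, hkt, htk⟩ := exists_edge_index hn h₀ h₁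
  exact Set.mem_biUnion (Finset.mem_coe.2 (Finset.mem_range.2 hk))
    (interp_mem_segment hk u hkt htk)

/-- The length of the initial part `[0, t]` of the path with vertices `u 0, …, u n`. -/
def arcLen (n : ℕ) (u : ℕ → Plane) (t : ℝ) : ℝ :=
  interp n (fun k => ∑ i ∈ Finset.range k, ‖u (i + 1) - u i‖) t

theorem arcLen_sub_of_mem {n k : ℕ} (hk : k < n) (u : ℕ → Plane) {s t : ℝ} (hs : (k : ℝ) ≤ s)
    (hst : s ≤ t) (ht : t ≤ k + 1) :
    arcLen n u t - arcLen n u s = ‖interp n u t - interp n u s‖ := by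
  rw [arcLen, arcLen, interp_sub_of_mem hk _ hs hst ht, interp_sub_of_mem hk _ hs hst ht,
    norm_smul, Real.norm_of_nonneg (by linarith), Finset.sum_range_succ, add_sub_cancel_left,
    smul_eq_mul]

theorem interp_natCast {V : Type*} [AddCommGroup V] [Module ℝ V] {n k : ℕ} (hk : k < n)
    (f : ℕ → V) : interp n f k = f k := by
  rw [interp_of_mem hk f le_rfl (by linarith), sub_self, zero_smul, add_zero]

theorem interp_natCast_add_one {V : Type*} [AddCommGroup V] [Module ℝ V] {n k : ℕ} (hk : k < n)
    (f : ℕ → V) : interp n f (k + 1) = f (k + 1) := by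
  rw [interp_of_mem hk f (by linarith) le_rfl, add_sub_cancel_left, one_smul, add_sub_cancel]

theorem arcLen_sub_eq_subLen {n i j : ℕ} (hij : i ≤ j) (hj : j < n) (u : ℕ → Plane) {s t : ℝ}
    (his : (i : ℝ) ≤ s) (hsi : s ≤ i + 1) (hjt : (j : ℝ) ≤ t) (htj : t ≤ j + 1) (hst : s ≤ t) :
    arcLen n u t - arcLen n u s = subLen u i j (interp n u s) (interp n u t) := by
  unfold subLen
  split_ifs with h
  · subst h
    exact arcLen_sub_of_mem hj u his hst htj
  · have hi : i < n := by omega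
    have h₁ := arcLen_sub_of_mem hi u his hsi le_rfl
    have h₂ := arcLen_sub_of_mem hj u le_rfl hjt htj
    rw [interp_natCast_add_one hi] at h₁
    rw [interp_natCast hj] at h₂
    have h₃ : arcLen n u j - arcLen n u (i + 1) =
        ∑ k ∈ Finset.Ico (i + 1) j, ‖u (k + 1) - u k‖ := by
      rw [arcLen, arcLen, interp_natCast hj, interp_natCast_add_one hi,
        Finset.sum_Ico_eq_sub _ (by omega)]
    linarith

theorem IsTamePath.isTameProfile {n : ℕ} {u : ℕ → Plane} (h : IsTamePath n u) :
    IsTameProfile n (fun t => interp n u t 0) (fun t => interp n u t 1) (arcLen n u) where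
  continuous_fst := by
    simp only [interp_apply]
    exact continuous_interp _ _
  continuous_snd := by
    simp only [interp_apply]
    exact continuous_interp _ _
  monotone_fst := by
    simp only [interp_apply]
    exact monotone_interp h.2.1
  edge_length k hk s t hs hst ht := by
    rw [arcLen_sub_of_mem hk u hs hst ht]
    refine (Plane.norm_le_abs_add_abs _).trans ?_
    have hx : interp n u s 0 ≤ interp n u t 0 := by
      simp only [interp_apply]
      exact monotone_interp h.2.1 hst
    simp only [PiLp.sub_apply]
    rw [abs_of_nonneg (sub_nonneg.2 hx)]
  edge_snd k hk := by
    simp only [interp_apply]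
    rcases le_total (u k 1) (u (k + 1) 1) with hle | hle
    · left
      intro s hs t ht hst
      have := interp_sub_of_mem hk (fun k => u k 1) hs.1 hst ht.2
      rw [smul_eq_mul] at this
      nlinarith [mul_nonneg (sub_nonneg.2 hst) (sub_nonneg.2 hle)]
    · right
      intro s hs t ht hst
      have := interp_sub_of_mem hk (fun k => u k 1) hs.1 hst ht.2
      rw [smul_eq_mul] at this
      nlinarith [mul_nonneg (sub_nonneg.2 hst) (sub_nonneg.2 hle)]
  chord_length s t hs hst ht hy hmin := by
    rcases hst.eq_or_lt with rfl | hlt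
    · simp
    have hn : 0 < n := by
      have : (0 : ℝ) < n := by linarith
      exact_mod_cast this
    obtain ⟨i, hi, his, hsi⟩ := exists_edge_index hn hs (hst.trans ht)
    obtain ⟨j, hj, hjt, htj⟩ := exists_edge_index hn (hs.trans hst) ht
    have hij : i ≤ j := by
      have : (i : ℝ) < j + 1 := by linarith
      exact Nat.lt_succ_iff.1 (by exact_mod_cast this)
    have hx : interp n u s 0 ≤ interp n u t 0 := by
      simp only [interp_apply]
      exact monotone_interp h.2.1 hst
    have hcont : Continuous fun r => interp n u r 0 := by
      simp only [interp_apply]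
      exact continuous_interp _ _
    rw [arcLen_sub_eq_subLen hij hj u his hsi hjt htj hst]
    have hsub : segment ℝ (interp n u s) (interp n u t) ⊆ belowRegion (pathSet n u) := by
      intro p hp
      have hp₀ := mem_segment_coord hp 0
      have hp₁ := mem_segment_coord hp 1
      rw [segment_eq_Icc hx] at hp₀
      rw [hy, segment_same, Set.mem_singleton_iff] at hp₁
      obtain ⟨r, hr, hxr⟩ := intermediate_value_Icc hst hcont.continuousOn hp₀
      exact ⟨⟨_, interp_mem_pathSet hn u (hs.trans hr.1) (hr.2.trans ht), hxr,
        hp₁.le.trans (hmin r hr)⟩, ⟨_, interp_mem_pathSet hn u (hs.trans hst) ht, hp₁.ge⟩⟩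
    refine (h.2.2 i j _ _ hij hj (interp_mem_segment hi u his hsi)
      (interp_mem_segment hj u hjt htj) hy hsub).trans_eq ?_
    rw [norm_sub_rev, Plane.norm_eq_abs_fst (by simp [hy]), PiLp.sub_apply,
      abs_of_nonneg (sub_nonneg.2 hx)]

theorem hasPath_interp {n : ℕ} (u : ℕ → Plane) {k : ℕ} (hk : k ≤ n) :
    ∀ {s t : ℝ}, 0 ≤ s → s ≤ t → t ≤ k →
      HasPath (pathEdges n u) (interp n u s) (interp n u t) (arcLen n u t - arcLen n u s) := by
  induction k with
  | zero =>
    intro s t hs hst ht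
    obtain rfl : s = t := le_antisymm hst (by simpa using ht.trans (by simpa using hs))
    exact HasPath.refl (by simp)
  | succ k ih =>
    intro s t hs hst ht
    push_cast at ht
    have hedge : ∀ {r : ℝ}, (k : ℝ) ≤ r → r ≤ t →
        HasPath (pathEdges n u) (interp n u r) (interp n u t)
          (arcLen n u t - arcLen n u r) := by
      intro r hr hrt
      exact HasPath.of_mem (e := (u k, u (k + 1)))
        (Finset.mem_image.2 ⟨k, Finset.mem_range.2 (by omega), rfl⟩)
        (interp_mem_segment (by omega) u hr (hrt.trans ht))
        (interp_mem_segment (by omega) u (hr.trans hrt) ht)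
        (arcLen_sub_of_mem (by omega) u hr hrt ht).ge
    rcases le_or_gt t k with htk | htk
    · exact ih (by omega) hs hst htk
    rcases le_or_gt (k : ℝ) s with hsk | hsk
    · exact hedge hsk hst
    · exact ((ih (by omega) hs hsk.le le_rfl).trans (hedge le_rfl htk.le)).mono subset_rfl
        (by linarith)

/-- The `j`-th node of level `m` of the binary tree rooted at `(0, -c)` whose leaves approach
height `-c + s * c`. -/
def treeNode (c s : ℝ) (m j : ℕ) : Plane :=
  pt (j * (1 / 2) ^ m) (-c + s * (c - c * (1 / 3) ^ m))

theorem abs_treeNode_fst_sub_le (c s : ℝ) (m j : ℕ) :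
    |(treeNode c s (m + 1) j - treeNode c s m (j / 2)) 0| ≤ (1 / 2) ^ (m + 1) := by
  have hj : (j : ℝ) = 2 * (j / 2 : ℕ) + (j % 2 : ℕ) := by exact_mod_cast (Nat.div_add_mod j 2).symm
  have hmod : ((j % 2 : ℕ) : ℝ) ≤ 1 := by
    exact_mod_cast Nat.lt_succ_iff.1 (Nat.mod_lt j two_pos)
  have heq : (treeNode c s (m + 1) j - treeNode c s m (j / 2)) 0 =
      (j % 2 : ℕ) * (1 / 2) ^ (m + 1) := by
    simp only [treeNode, PiLp.sub_apply, pt_zero]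
    rw [hj, pow_succ]
    ring
  rw [heq, abs_of_nonneg (by positivity)]
  exact mul_le_of_le_one_left (by positivity) hmod

theorem abs_treeNode_snd_sub {c s : ℝ} (hc : 0 < c) (hs : |s| = 1) (m j : ℕ) :
    |(treeNode c s (m + 1) j - treeNode c s m (j / 2)) 1| = 2 / 3 * (c * (1 / 3) ^ m) := by
  have heq : (treeNode c s (m + 1) j - treeNode c s m (j / 2)) 1 =
      s * (2 / 3 * (c * (1 / 3) ^ m)) := by
    simp only [treeNode, PiLp.sub_apply, pt_one]
    rw [pow_succ]
    ring
  rw [heq, abs_mul, hs, one_mul, abs_of_pos (by positivity)]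

theorem exists_tree_to_level {c s : ℝ} (hc : 0 < c) (hs : |s| = 1) (m : ℕ) :
    ∃ T : Finset (Plane × Plane), gweight T ≤ 4 * c * (1 - (2 / 3) ^ m) + m ∧
      ∀ j < 2 ^ m, HasPath T (pt 0 (-c)) (treeNode c s m j)
        (c - c * (1 / 3) ^ m + 3 / 4 * c⁻¹ * (1 - (3 / 4) ^ m)) := by
  induction m with
  | zero =>
    refine ⟨∅, by simp [gweight], fun j hj => ?_⟩
    obtain rfl : j = 0 := by simpa using hj
    have : treeNode c s 0 0 = pt 0 (-c) := by simp [treeNode]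
    rw [this]
    exact HasPath.refl (by simp)
  | succ m ih =>
    obtain ⟨T, hT, hpath⟩ := ih
    set f : ℕ → Plane × Plane := fun j => (treeNode c s m (j / 2), treeNode c s (m + 1) j)
    refine ⟨T ∪ (Finset.range (2 ^ (m + 1))).image f, ?_, fun j hj => ?_⟩
    · have hw := gweight_image_range_le f (2 ^ (m + 1))
        (m := (1 / 2) ^ (m + 1) + 2 / 3 * (c * (1 / 3) ^ m)) (by positivity) (fun j _ => by
          rw [norm_sub_rev]
          exact (Plane.norm_le_abs_add_abs _).trans
            (add_le_add (abs_treeNode_fst_sub_le c s m j) (abs_treeNode_snd_sub hc hs m j).le))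
      have heq : ((2 ^ (m + 1) : ℕ) : ℝ) * ((1 / 2) ^ (m + 1) + 2 / 3 * (c * (1 / 3) ^ m)) =
          1 + 4 / 3 * c * (2 / 3) ^ m := by
        have h₁ : (2 : ℝ) ^ (m + 1) * (1 / 2) ^ (m + 1) = 1 := by
          rw [← mul_pow]
          norm_num
        have h₂ : (2 : ℝ) ^ m * (1 / 3) ^ m = (2 / 3) ^ m := by
          rw [← mul_pow]
          norm_num
        push_cast
        rw [mul_add, h₁, ← h₂]
        ring
      rw [heq] at hw
      refine (gweight_union_le _ _).trans ((add_le_add hT hw).trans_eq ?_)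
      push_cast
      ring
    · have hedge : HasPath (T ∪ (Finset.range (2 ^ (m + 1))).image f) (treeNode c s m (j / 2))
          (treeNode c s (m + 1) j) (2 / 3 * (c * (1 / 3) ^ m) +
            ((1 / 2) ^ (m + 1)) ^ 2 / (2 * (2 / 3 * (c * (1 / 3) ^ m)))) :=
        HasPath.of_mem (e := f j)
          (Finset.mem_union_right _ (Finset.mem_image_of_mem f (Finset.mem_range.2 hj)))
          (left_mem_segment ℝ _ _) (right_mem_segment ℝ _ _)
          (Plane.norm_le_add_sq_div (by positivity) (abs_treeNode_fst_sub_le c s m j)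
            (abs_treeNode_snd_sub hc hs m j))
      have hj' : j / 2 < 2 ^ m := by
        rw [pow_succ] at hj
        omega
      refine (((hpath (j / 2) hj').mono Finset.subset_union_left le_rfl).trans hedge).mono
        subset_rfl (le_of_eq ?_)
      have heq : ((1 / 2 : ℝ) ^ (m + 1)) ^ 2 / (2 * (2 / 3 * (c * (1 / 3) ^ m))) =
          3 / 16 * c⁻¹ * (3 / 4) ^ m := by
        have h₁ : ((1 / 2 : ℝ) ^ (m + 1)) ^ 2 = 1 / 4 * (3 / 4) ^ m * (1 / 3) ^ m := by
          rw [mul_assoc, ← mul_pow, ← pow_mul, mul_comm (m + 1), pow_mul, pow_succ]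
          norm_num
          ring
        rw [h₁]
        field_simp
        norm_num
      rw [heq, pow_succ, pow_succ]
      ring

/-- A tree of weight `O(c + k)` that joins `(0, -c)` to the `2 ^ k` grid points at height
`-c + s * c` by paths of length `c + O(1 / c)`. -/
theorem exists_tree {c s : ℝ} (hc : 0 < c) (hs : |s| = 1) (k : ℕ) :
    ∃ T : Finset (Plane × Plane), gweight T ≤ 5 * c + k ∧
      ∀ j : ℕ, j < 2 ^ k → HasPath T (pt 0 (-c)) (pt ((j : ℝ) / (2 ^ k : ℕ)) (-c + s * c))
        (c + c⁻¹) := by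
  obtain ⟨T, hT, hpath⟩ := exists_tree_to_level hc hs k
  set leaf : ℕ → Plane := fun j => pt ((j : ℝ) / (2 ^ k : ℕ)) (-c + s * c) with hleaf
  set f : ℕ → Plane × Plane := fun j => (treeNode c s k j, leaf j)
  have hnorm : ∀ j, ‖leaf j - treeNode c s k j‖ ≤ c * (1 / 3) ^ k := by
    intro j
    refine (Plane.norm_le_abs_add_abs _).trans (le_of_eq ?_)
    have h₀ : (leaf j - treeNode c s k j) 0 = 0 := by
      simp [hleaf, treeNode, div_eq_mul_inv]
    have h₁ : (leaf j - treeNode c s k j) 1 = s * (c * (1 / 3) ^ k) := by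
      simp only [hleaf, treeNode, PiLp.sub_apply, pt_one]
      ring
    rw [h₀, h₁, abs_mul, hs, abs_zero, zero_add, one_mul, abs_of_pos (by positivity)]
  refine ⟨T ∪ (Finset.range (2 ^ k)).image f, ?_, fun j hj => ?_⟩
  · have hw := gweight_image_range_le f (2 ^ k) (m := c * (1 / 3) ^ k) (by positivity)
      (fun j _ => by
        rw [norm_sub_rev]
        exact hnorm j)
    have heq : ((2 ^ k : ℕ) : ℝ) * (c * (1 / 3) ^ k) = c * (2 / 3) ^ k := by
      rw [show (2 / 3 : ℝ) = 2 * (1 / 3) by norm_num, mul_pow]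
      push_cast
      ring
    have hpow : (2 / 3 : ℝ) ^ k ≤ 1 := pow_le_one₀ (by norm_num) (by norm_num)
    rw [heq] at hw
    refine (gweight_union_le _ _).trans ((add_le_add hT hw).trans ?_)
    have : 0 < (2 / 3 : ℝ) ^ k := by positivity
    nlinarith
  · have hedge : HasPath (T ∪ (Finset.range (2 ^ k)).image f) (treeNode c s k j) (leaf j)
        (c * (1 / 3) ^ k) :=
      HasPath.of_mem (e := f j)
        (Finset.mem_union_right _ (Finset.mem_image_of_mem f (Finset.mem_range.2 hj)))
        (left_mem_segment ℝ _ _) (right_mem_segment ℝ _ _) (hnorm j)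
    refine (((hpath j hj).mono Finset.subset_union_left le_rfl).trans hedge).mono subset_rfl ?_
    have h₁ : 0 < c⁻¹ := inv_pos.2 hc
    have h₂ : 0 < (3 / 4 : ℝ) ^ k := by positivity
    nlinarith [mul_pos h₁ h₂]

/-- The unit horizontal segment from `(0, y)` to `(1, y)`. -/
def horizontalEdge (y : ℝ) : Plane × Plane := (pt 0 y, pt 1 y)

/-- The unit vertical segment from `(x, 0)` to `(x, 1)`. -/
def verticalEdge (x : ℝ) : Plane × Plane := (pt x 0, pt x 1)

theorem norm_horizontalEdge (y : ℝ) : ‖(horizontalEdge y).1 - (horizontalEdge y).2‖ = 1 := by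
  rw [Plane.norm_eq_abs_fst] <;> simp [horizontalEdge]

theorem norm_verticalEdge_le (x : ℝ) : ‖(verticalEdge x).1 - (verticalEdge x).2‖ ≤ 1 :=
  (Plane.norm_le_abs_add_abs _).trans (by simp [verticalEdge])

theorem hasPath_horizontal {E : Finset (Plane × Plane)} {y : ℝ} (h : horizontalEdge y ∈ E)
    {x₁ x₂ w : ℝ} (h₁ : x₁ ∈ Set.Icc 0 1) (h₂ : x₂ ∈ Set.Icc 0 1) (hw : |x₂ - x₁| ≤ w) :
    HasPath E (pt x₁ y) (pt x₂ y) w := by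
  refine HasPath.of_mem h (pt_mem_segment_horizontal h₁) (pt_mem_segment_horizontal h₂) ?_
  rwa [Plane.norm_eq_abs_fst (by simp), PiLp.sub_apply, pt_zero, pt_zero]

theorem hasPath_vertical {E : Finset (Plane × Plane)} {x : ℝ} (h : verticalEdge x ∈ E)
    {y : ℝ} (hy : y ∈ Set.Icc 0 1) : HasPath E (pt x y) (pt x 0) y := by
  refine HasPath.of_mem h (pt_mem_segment_vertical hy) (left_mem_segment ℝ _ _)
    ((Plane.norm_le_abs_add_abs _).trans (le_of_eq ?_))
  simp [abs_of_nonneg hy.1]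

theorem div_mem_Icc {i N : ℕ} (h : i < N) : (i : ℝ) / N ∈ Set.Icc (0 : ℝ) 1 := by
  refine ⟨by positivity, div_le_one_of_le₀ ?_ (by positivity)⟩
  exact_mod_cast h.le

theorem hasPath_horizontal_to_grid {E : Finset (Plane × Plane)} {N : ℕ} (hN : 0 < N) {x y : ℝ}
    (h : horizontalEdge y ∈ E) (hx : x ∈ Set.Icc 0 1) :
    ∃ i < N, HasPath E (pt x y) (pt ((i : ℝ) / N) y) (1 / N) := by
  obtain ⟨i, hi, h₁, h₂⟩ := exists_grid_cell hN hx
  exact ⟨i, hi, hasPath_horizontal h hx (div_mem_Icc hi)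
    (abs_le.2 ⟨by linarith, by linarith [show (0 : ℝ) ≤ 1 / N by positivity]⟩)⟩

/-- The grid of mesh `1 / N` in the unit square, with one more horizontal line at height `h`. -/
def squareGrid (N : ℕ) (h : ℝ) : Finset (Plane × Plane) :=
  ((Finset.range N).image fun i : ℕ => verticalEdge ((i : ℝ) / N)) ∪
    (((Finset.range (N + 1)).image fun j : ℕ => horizontalEdge ((j : ℝ) / N)) ∪
      {horizontalEdge h})

theorem gweight_horizontalEdge (y : ℝ) : gweight {horizontalEdge y} = 1 := by
  rw [gweight, Finset.sum_singleton, norm_horizontalEdge]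

theorem gweight_squareGrid_le (N : ℕ) (h : ℝ) : gweight (squareGrid N h) ≤ 2 * N + 2 := by
  have h₁ := gweight_image_range_le (fun i : ℕ => verticalEdge ((i : ℝ) / N)) N zero_le_one
    fun i _ => norm_verticalEdge_le _
  have h₂ := gweight_image_range_le (fun j : ℕ => horizontalEdge ((j : ℝ) / N)) (N + 1)
    zero_le_one fun j _ => (norm_horizontalEdge _).le
  push_cast at h₂
  have h₃ := gweight_horizontalEdge h
  have h₄ := gweight_union_le ((Finset.range N).image fun i : ℕ => verticalEdge ((i : ℝ) / N))
    (((Finset.range (N + 1)).image fun j : ℕ => horizontalEdge ((j : ℝ) / N)) ∪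
      {horizontalEdge h})
  have h₅ := gweight_union_le
    ((Finset.range (N + 1)).image fun j : ℕ => horizontalEdge ((j : ℝ) / N)) {horizontalEdge h}
  unfold squareGrid
  linarith

theorem hasPath_squareGrid {N : ℕ} (hN : 0 < N) {h x y : ℝ} (hx : x ∈ Set.Icc 0 1)
    (hy : y ∈ Set.Icc 0 1)
    (hgrid : y = h ∨ (∃ i < N, x = (i : ℝ) / N) ∨ ∃ j ≤ N, y = (j : ℝ) / N) :
    ∃ i < N, HasPath (squareGrid N h) (pt x y) (pt ((i : ℝ) / N) 0) (1 / N + y) := by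
  have hvert : ∀ i < N, verticalEdge ((i : ℝ) / N) ∈ squareGrid N h := fun i hi =>
    Finset.mem_union_left _ (Finset.mem_image.2 ⟨i, Finset.mem_range.2 hi, rfl⟩)
  have hhor : horizontalEdge y ∈ squareGrid N h → ∃ i < N,
      HasPath (squareGrid N h) (pt x y) (pt ((i : ℝ) / N) 0) (1 / N + y) := by
    intro hmem
    obtain ⟨i, hi, hpath⟩ := hasPath_horizontal_to_grid hN hmem hx
    exact ⟨i, hi, hpath.trans (hasPath_vertical (hvert i hi) hy)⟩
  rcases hgrid with rfl | ⟨i, hi, rfl⟩ | ⟨j, hj, rfl⟩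
  · exact hhor (by simp [squareGrid])
  · exact ⟨i, hi, (hasPath_vertical (hvert i hi) hy).mono subset_rfl
      (le_add_of_nonneg_left (by positivity))⟩
  · exact hhor (Finset.mem_union_right _ (Finset.mem_union_left _
      (Finset.mem_image.2 ⟨j, Finset.mem_range.2 (by omega), rfl⟩)))

theorem IsTamePath.exists_hasPath_to_grid {n : ℕ} {u : ℕ → Plane} (h : IsTamePath n u)
    (hQ : ∀ p ∈ pathSet n u, (0 ≤ p 0 ∧ p 0 ≤ 1) ∧ (0 ≤ p 1 ∧ p 1 ≤ 1)) {N : ℕ} (hN : 0 < N)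
    {a : Plane} (ha : a ∈ pathSet n u) :
    ∃ i < N, HasPath (pathEdges n u ∪ squareGrid N (u 0 1)) a (pt ((i : ℝ) / N) 0)
      (a 1 + 6 * (1 / N)) := by
  obtain ⟨k, hk, hak⟩ := Set.mem_iUnion₂.1 ha
  have hk := Finset.mem_range.1 hk
  obtain ⟨t, hkt, htk, rfl⟩ := exists_interp_eq hk hak
  have ht₀ : 0 ≤ t := k.cast_nonneg.trans hkt
  have ht : t ≤ n := htk.trans (by exact_mod_cast hk)
  have hQt := hQ _ ha
  obtain ⟨s, hs₀, hst, hlen, hy, hgrid⟩ := h.isTameProfile.exists_grid_point hN ht₀ ht hQt.1 hQt.2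
  have hQs := hQ _ (interp_mem_pathSet (by omega) u hs₀ (hst.trans ht))
  have hgrid' : interp n u s 1 = u 0 1 ∨ (∃ i < N, interp n u s 0 = (i : ℝ) / N) ∨
      ∃ j ≤ N, interp n u s 1 = (j : ℝ) / N := by
    refine hgrid.imp_left ?_
    rintro rfl
    have := interp_natCast (show 0 < n by omega) u
    rw [Nat.cast_zero] at this
    rw [this]
  obtain ⟨i, hi, hpath⟩ := hasPath_squareGrid hN hQs.1 hQs.2 hgrid'
  rw [pt_eta] at hpath
  refine ⟨i, hi, (((hasPath_interp u le_rfl hs₀ hst ht).symm.mono Finset.subset_union_left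
    le_rfl).trans (hpath.mono Finset.subset_union_right le_rfl)).mono subset_rfl ?_⟩
  linarith

-- **Statement 16.** There is an absolute constant `C > 0` such that for every
-- `ε ∈ (0,1]` the following holds. Let `R = [0,1] × [−2ε^{-1/2}, 0]`, let
-- `Q = [0,1] × [0,1]` be the unit square adjacent to the top side of `R`, and let `L`
-- be a tame path contained in `Q`. Then there is a geometric graph comprised of the
-- edges of `L` and additional segments of total weight at most `C·ε^{-1/2}` containing,
-- for every `a ∈ L` and every `b` on the bottom side of `R`, an `ab`-path of weight at
-- most `(1 + C·ε)·‖a − b‖`.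
theorem tame_square_to_base_spanner :
    ∃ C : ℝ, 0 < C ∧
      ∀ ε : ℝ, 0 < ε → ε ≤ 1 →
      ∀ (n : ℕ) (u : ℕ → Plane), IsTamePath n u →
        (∀ p ∈ pathSet n u, (0 ≤ p 0 ∧ p 0 ≤ 1) ∧ (0 ≤ p 1 ∧ p 1 ≤ 1)) →
        ∃ Ex : Finset (Plane × Plane),
          gweight Ex ≤ C * (Real.sqrt ε)⁻¹ ∧
          ∀ a ∈ pathSet n u,
          ∀ b ∈ segment ℝ (pt 0 (-(2 * (Real.sqrt ε)⁻¹))) (pt 1 (-(2 * (Real.sqrt ε)⁻¹))),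
            HasPath (pathEdges n u ∪ Ex) a b ((1 + C * ε) * ‖a - b‖) := by
  refine ⟨21, by norm_num, fun ε hε₀ hε₁ n u hu hQ => ?_⟩
  set σ := Real.sqrt ε
  have hσ₀ : 0 < σ := Real.sqrt_pos.2 hε₀
  have hσ₁ : σ ≤ 1 := Real.sqrt_le_one.2 hε₁
  have hσε : σ * σ = ε := Real.mul_self_sqrt hε₀.le
  have hσinv : σ * σ⁻¹ = 1 := mul_inv_cancel₀ hσ₀.ne'
  have hc₁ : 1 ≤ σ⁻¹ := (one_le_inv₀ hσ₀).2 hσ₁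
  have hc₀ : 0 < σ⁻¹ := inv_pos.2 hσ₀
  obtain ⟨k, hk, hk'⟩ := exists_nat_pow_near hc₁ (one_lt_two (α := ℝ))
  obtain ⟨N, hN⟩ : ∃ N : ℕ, N = 2 ^ (k + 1) := ⟨_, rfl⟩
  have hN₀ : 0 < N := hN ▸ by positivity
  have hNr : (N : ℝ) = 2 ^ (k + 1) := by rw [hN]; push_cast; rfl
  have hN₁ : (N : ℝ) ≤ 2 * σ⁻¹ := by rw [hNr, pow_succ]; linarith
  have hN₂ : 1 / (N : ℝ) ≤ σ := by
    rw [one_div, hNr]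
    exact inv_le_of_inv_le₀ hσ₀ hk'.le
  have hkN : ((k + 1 : ℕ) : ℝ) ≤ N := by
    rw [hN]
    exact_mod_cast Nat.lt_two_pow_self.le
  obtain ⟨T, hT, hTpath⟩ := exists_tree hc₀ (s := 1) (by simp) (k + 1)
  obtain ⟨B, hB, hBpath⟩ := exists_tree hc₀ (s := -1) (by simp) (k + 1)
  rw [← hN] at hTpath hBpath
  set bot := horizontalEdge (-(2 * σ⁻¹))
  refine ⟨squareGrid N (u 0 1) ∪ (T ∪ (B ∪ {bot})), ?_, fun a ha b hb => ?_⟩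
  · have h₁ := gweight_squareGrid_le N (u 0 1)
    have h₂ := gweight_horizontalEdge (-(2 * σ⁻¹))
    have h₃ := gweight_union_le (squareGrid N (u 0 1)) (T ∪ (B ∪ {bot}))
    have h₄ := gweight_union_le T (B ∪ {bot})
    have h₅ := gweight_union_le B {bot}
    linarith
  · obtain ⟨i, hi, hai⟩ := hu.exists_hasPath_to_grid hQ hN₀ ha
    have hb₁ : b 1 = -(2 * σ⁻¹) := by simpa using mem_segment_coord hb 1
    have hb₀ : b 0 ∈ Set.Icc 0 1 := by
      have := mem_segment_coord hb 0
      rwa [pt_zero, pt_zero, segment_eq_Icc zero_le_one] at this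
    obtain ⟨j, hj, hbj⟩ := hasPath_horizontal_to_grid (E := {bot}) hN₀
      (Finset.mem_singleton_self _) hb₀
    rw [← hb₁, pt_eta, hb₁] at hbj
    have hTi := hTpath i hi
    have hBj := hBpath j hj
    rw [show -σ⁻¹ + 1 * σ⁻¹ = 0 by ring, inv_inv] at hTi
    rw [show -σ⁻¹ + -1 * σ⁻¹ = -(2 * σ⁻¹) by ring, inv_inv] at hBj
    set E := pathEdges n u ∪ (squareGrid N (u 0 1) ∪ (T ∪ (B ∪ {bot}))) with hE
    have hsub₁ : pathEdges n u ∪ squareGrid N (u 0 1) ⊆ E := by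
      rw [hE, ← Finset.union_assoc]
      exact Finset.subset_union_left
    have hsub₂ : T ⊆ E := fun e he => by simp [hE, he]
    have hsub₃ : B ⊆ E := fun e he => by simp [hE, he]
    have hsub₄ : {bot} ⊆ E := fun e he => by simp [hE, Finset.mem_singleton.1 he]
    refine ((hai.mono hsub₁ le_rfl).trans ((hTi.symm.mono hsub₂ le_rfl).trans
      ((hBj.mono hsub₃ le_rfl).trans (hbj.symm.mono hsub₄ le_rfl)))).mono subset_rfl ?_
    have hdist : a 1 + 2 * σ⁻¹ ≤ ‖a - b‖ := by
      have := (le_abs_self _).trans (Plane.abs_snd_le_norm (a - b))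
      rw [PiLp.sub_apply, hb₁] at this
      linarith
    have hslack : σ * 2 ≤ ε * ‖a - b‖ := by
      calc σ * 2 = ε * (2 * σ⁻¹) := by rw [← hσε]; linear_combination (-2 * σ) * hσinv
        _ ≤ ε * ‖a - b‖ := by
          gcongr
          linarith [(hQ a ha).2.1]
    linarith

end
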